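/- Let p ≥ 1, let x be a standard Gaussian random vector on ℝ^p, let ε ∼ N(0, σ²) with σ > 0 be independent of x, and let w, w* ∈ {0,1}^p with exactly k ≥ 1 nonzero entries each and w^T w* = ℓ where 0 ≤ ℓ < k. Then ℙ( sign(x^T w*+ε) = sign(x^T w*) and sign(x^T w*+ε) ≠ sign(x^T w) ) = (1/(2π)) [ π/2 − arcsin( ℓ/√(k(k+σ²)) ) + arcsin( k/√(k(k+σ²)) ) − arcsin( ℓ/k ) ]. -/

import Mathlib

open scoped BigOperators
open Real MeasureTheory ProbabilityTheory

/-- `sgn λ = 1` if `λ > 0` and `-1` otherwise. -/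
noncomputable def sgn (t : ℝ) : ℝ := if 0 < t then 1 else -1

lemma aux_polar : ∃ C : ENNReal, ∀ (S : Set (ℝ × ℝ)) (T : Set ℝ), MeasurableSet S →
    MeasurableSet T →
    (∀ r φ : ℝ, 0 < r → φ ∈ Set.Ioo (-π) π → ((r * cos φ, r * sin φ) ∈ S ↔ φ ∈ T)) →
    ((gaussianReal 0 1).prod (gaussianReal 0 1)) S = C * volume (T ∩ Set.Ioo (-π) π) := by
  refine ⟨∫⁻ r in Set.Ioi (0:ℝ), ENNReal.ofReal r *
    ENNReal.ofReal ((√(2 * π))⁻¹ * (√(2 * π))⁻¹ * rexp (- r ^ 2 / 2)), ?_⟩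
  intro S T hS hT h
  rw [gaussianReal_of_var_ne_zero _ one_ne_zero,
    prod_withDensity (measurable_gaussianPDF _ _) (measurable_gaussianPDF _ _),
    withDensity_apply _ hS, ← lintegral_indicator hS, ← Measure.volume_eq_prod,
    ← lintegral_comp_polarCoord_symm, polarCoord_target]
  have e : ∀ p ∈ Set.Ioi (0:ℝ) ×ˢ Set.Ioo (-π) π,
      ENNReal.ofReal p.1 • S.indicator (fun z : ℝ × ℝ => gaussianPDF 0 1 z.1 * gaussianPDF 0 1 z.2)
        (polarCoord.symm p) =
      (fun p : ℝ × ℝ => (fun r : ℝ => ENNReal.ofReal r *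
    ENNReal.ofReal ((√(2 * π))⁻¹ * (√(2 * π))⁻¹ * rexp (- r ^ 2 / 2))) p.1 *
        (T.indicator (fun _ => (1 : ENNReal))) p.2) p := by
    rintro ⟨r, φ⟩ ⟨hr, hφ⟩
    have := h r φ hr hφ
    simp only [polarCoord_symm_apply, smul_eq_mul]
    by_cases hm : φ ∈ T
    · rw [Set.indicator_of_mem hm, Set.indicator_of_mem (this.2 hm), mul_one]
      congr 1
      simp only [gaussianPDF, gaussianPDFReal]
      rw [← ENNReal.ofReal_mul (by positivity)]
      congr 1
      have : rexp (- r ^ 2 / 2) = rexp (-(r * cos φ) ^ 2 / 2) * rexp (-(r * sin φ) ^ 2 / 2) := by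
        rw [← Real.exp_add]; congr 1
        linear_combination (r ^ 2 / 2) * sin_sq_add_cos_sq φ
      rw [this]; simp; ring
    · rw [Set.indicator_of_notMem hm, Set.indicator_of_notMem (fun hh => hm (this.1 hh))]
      simp
  rw [setLIntegral_congr_fun (measurableSet_Ioi.prod measurableSet_Ioo) e,
    Measure.volume_eq_prod, ← Measure.prod_restrict]
  refine (lintegral_prod_mul (f := fun r : ℝ => ENNReal.ofReal r *
    ENNReal.ofReal ((√(2 * π))⁻¹ * (√(2 * π))⁻¹ * rexp (- r ^ 2 / 2)))
    (g := T.indicator (fun _ => (1 : ENNReal))) ?_ ?_).trans ?_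
  rotate_left 2
  · congr 1
    rw [lintegral_indicator hT]
    simp [hT]
  · fun_prop
  · exact (measurable_const.indicator hT).aemeasurable

lemma sgn_ne_iff (a b : ℝ) : sgn a ≠ sgn b ↔ ¬ (0 < a ↔ 0 < b) := by
  unfold sgn
  by_cases h1 : 0 < a <;> by_cases h2 : 0 < b <;> simp [h1, h2] <;> norm_num

lemma measurable_sgn : Measurable sgn :=
  Measurable.ite measurableSet_Ioi measurable_const measurable_const

lemma aux_std (θ : ℝ) (h0 : 0 < θ) (h1 : θ < π) :
    ((gaussianReal 0 1).prod (gaussianReal 0 1))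
      {p : ℝ × ℝ | sgn p.2 ≠ sgn (cos θ * p.2 - sin θ * p.1)} = ENNReal.ofReal (θ / π) := by
  obtain ⟨C, hC⟩ := aux_polar
  have hpi := Real.pi_pos
  have t := hC Set.univ Set.univ .univ .univ (by simp)
  rw [hC _ (Set.Ioc 0 θ ∪ Set.Ioo (-π) (θ - π)) ?_ (measurableSet_Ioc.union measurableSet_Ioo) ?_]
  · have : (Set.Ioc 0 θ ∪ Set.Ioo (-π) (θ - π)) ∩ Set.Ioo (-π) π
        = Set.Ioc 0 θ ∪ Set.Ioo (-π) (θ - π) := by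
      rw [Set.inter_eq_left]
      rintro x (⟨h2, h3⟩ | ⟨h2, h3⟩) <;> constructor <;> linarith
    rw [this, measure_union _ measurableSet_Ioo, Real.volume_Ioc, Real.volume_Ioo,
      ← ENNReal.ofReal_add (by linarith) (by linarith)]
    · simp only [measure_univ, Set.univ_inter, Real.volume_Ioo] at t
      have : C = (ENNReal.ofReal (π - -π))⁻¹ := ENNReal.eq_inv_of_mul_eq_one_left t.symm
      rw [this, ← ENNReal.ofReal_inv_of_pos (by linarith), ← ENNReal.ofReal_mul (by
        rw [inv_nonneg]; linarith)]
      congr 1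
      field_simp
      ring
    · rw [Set.disjoint_left]
      rintro x ⟨h2, h3⟩ ⟨h4, h5⟩
      linarith
  · have m1 : Measurable fun p : ℝ × ℝ => sgn p.2 := measurable_sgn.comp measurable_snd
    have m2 : Measurable fun p : ℝ × ℝ => sgn (cos θ * p.2 - sin θ * p.1) :=
      measurable_sgn.comp (by fun_prop)
    exact (measurableSet_eq_fun m1 m2).compl
  · intro r φ hr hφ
    have e1 : cos θ * (r * sin φ) - sin θ * (r * cos φ) = r * sin (φ - θ) := by
      rw [sin_sub]; ring
    simp only [Set.mem_ofPred_eq, sgn_ne_iff, e1, mul_pos_iff_of_pos_left hr]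
    obtain ⟨a1, a2⟩ := hφ
    have s1 : 0 < sin φ ↔ 0 < φ := by
      constructor
      · intro h; by_contra hh
        exact absurd (sin_nonpos_of_nonpos_of_neg_pi_le (not_lt.1 hh) a1.le) (not_le.2 h)
      · intro h; exact sin_pos_of_pos_of_lt_pi h a2
    have s2 : 0 < sin (φ - θ) ↔ (θ < φ ∨ φ < θ - π) := by
      constructor
      · intro h; by_contra! hh
        exact absurd (sin_nonpos_of_nonpos_of_neg_pi_le (by linarith) (by linarith)) (not_le.2 h)
      · rintro (h | h)
        · exact sin_pos_of_pos_of_lt_pi (by linarith) (by linarith)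
        · rw [← sin_add_two_pi]; exact sin_pos_of_pos_of_lt_pi (by linarith) (by linarith)
    rw [s1, s2]
    simp only [Set.mem_union, Set.mem_Ioc, Set.mem_Ioo]
    constructor
    · intro h
      by_contra! hh
      apply h
      constructor
      · intro h'; left; exact hh.1 h'
      · rintro (h' | h')
        · linarith
        · linarith [hh.2 a1]
    · rintro (⟨h, h'⟩ | ⟨h, h'⟩) hh
      · rcases hh.1 h with h2 | h2 <;> linarith
      · linarith [hh.2 (Or.inr h')]

lemma sgn_mul_pos (a t : ℝ) (ha : 0 < a) : sgn (a * t) = sgn t := by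
  unfold sgn; simp [mul_pos_iff_of_pos_left ha]

lemma cov_bilin {Ω : Type*} [MeasurableSpace Ω] {μ : Measure Ω} [IsProbabilityMeasure μ]
    {U V : Ω → ℝ} (hU : MemLp U 2 μ) (hV : MemLp V 2 μ) (α β γ δ : ℝ) :
    cov[fun ω => α * U ω + β * V ω, fun ω => γ * U ω + δ * V ω; μ] =
      α * γ * cov[U, U; μ] + (α * δ + β * γ) * cov[U, V; μ] + β * δ * cov[V, V; μ] := by
  have e : ∀ α β : ℝ, (fun ω => α * U ω + β * V ω) = α • U + β • V := by
    intro α β; ext ω; simp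
  rw [e, e, covariance_add_left (hU.const_smul _) (hV.const_smul _)
    ((hU.const_smul _).add (hV.const_smul _)),
    covariance_add_right (hU.const_smul _) (hU.const_smul _) (hV.const_smul _),
    covariance_add_right (hV.const_smul _) (hU.const_smul _) (hV.const_smul _)]
  simp only [covariance_smul_left, covariance_smul_right]
  rw [covariance_comm V U]; ring

lemma aux_pair {Ω : Type*} [MeasurableSpace Ω] {μ : Measure Ω} [IsProbabilityMeasure μ]
    {U V : Ω → ℝ} (h : HasGaussianLaw (fun ω => (U ω, V ω)) μ)
    (hU0 : ∫ ω, U ω ∂μ = 0) (hV0 : ∫ ω, V ω ∂μ = 0) (a b ρ : ℝ) (ha : 0 < a) (hb : 0 < b)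
    (hρ : |ρ| < 1) (hUU : cov[U, U; μ] = a ^ 2) (hVV : cov[V, V; μ] = b ^ 2)
    (hUV : cov[U, V; μ] = a * b * ρ) :
    μ.real {ω | sgn (U ω) ≠ sgn (V ω)} = 1 / 2 - arcsin ρ / π := by
  obtain ⟨r1, r2⟩ := abs_lt.1 hρ
  have hpi := Real.pi_pos
  have hsin : sin (arccos ρ) = √(1 - ρ ^ 2) := sin_arccos ρ
  have hcos : cos (arccos ρ) = ρ := cos_arccos r1.le r2.le
  set s := √(1 - ρ ^ 2) with hs
  have hs2 : s ^ 2 = 1 - ρ ^ 2 := Real.sq_sqrt (by nlinarith)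
  have hs0 : 0 < s := Real.sqrt_pos.2 (by nlinarith)
  have h0 : 0 < arccos ρ := arccos_pos.2 r2
  have h1 : arccos ρ < π := by
    rw [arccos]; have := neg_pi_div_two_lt_arcsin.2 r1; linarith
  have mU := h.fst.memLp_two
  have mV := h.snd.memLp_two
  set X : Ω → ℝ := fun ω => (s⁻¹ * ρ * a⁻¹) * U ω + (- s⁻¹ * b⁻¹) * V ω with hX
  set Y : Ω → ℝ := fun ω => a⁻¹ * U ω + 0 * V ω with hY
  have hXY : HasGaussianLaw (fun ω => (X ω, Y ω)) μ := by
    have := h.map_fun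
      (((s⁻¹ * ρ * a⁻¹) • ContinuousLinearMap.fst ℝ ℝ ℝ
        + (- s⁻¹ * b⁻¹) • ContinuousLinearMap.snd ℝ ℝ ℝ).prod
        (a⁻¹ • ContinuousLinearMap.fst ℝ ℝ ℝ + (0:ℝ) • ContinuousLinearMap.snd ℝ ℝ ℝ))
    simpa [hX, hY] using this
  have c1 : cov[X, Y; μ] = 0 := by
    rw [hX, hY, cov_bilin mU mV, hUU, hVV, hUV]; field_simp; ring
  have c2 : cov[X, X; μ] = 1 := by
    rw [hX, cov_bilin mU mV, hUU, hVV, hUV]; field_simp; linarith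
  have c3 : cov[Y, Y; μ] = 1 := by
    rw [hY, cov_bilin mU mV, hUU, hVV, hUV]; field_simp; ring
  have iU := mU.integrable one_le_two
  have iV := mV.integrable one_le_two
  have lin : ∀ α β : ℝ, ∫ ω, (α * U ω + β * V ω) ∂μ = 0 := by
    intro α β
    rw [integral_add (iU.const_mul _) (iV.const_mul _), integral_const_mul, integral_const_mul,
      hU0, hV0]; simp
  have lX : μ.map X = gaussianReal 0 1 := by
    rw [hXY.fst.map_eq_gaussianReal, ← covariance_self hXY.fst.aemeasurable, c2, lin]; simp
  have lY : μ.map Y = gaussianReal 0 1 := by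
    rw [hXY.snd.map_eq_gaussianReal, ← covariance_self hXY.snd.aemeasurable, c3, lin]; simp
  have ind := hXY.indepFun_of_covariance_eq_zero c1
  have law := (indepFun_iff_map_prod_eq_prod_map_map hXY.fst.aemeasurable
    hXY.snd.aemeasurable).1 ind
  rw [lX, lY] at law
  have key := aux_std _ h0 h1
  rw [← law, Measure.map_apply_of_aemeasurable hXY.aemeasurable] at key
  · have : {ω | sgn (U ω) ≠ sgn (V ω)} = (fun ω => (X ω, Y ω)) ⁻¹'
      {p : ℝ × ℝ | sgn p.2 ≠ sgn (cos (arccos ρ) * p.2 - sin (arccos ρ) * p.1)} := by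
      ext ω
      simp only [Set.mem_preimage, Set.mem_ofPred_eq]
      have e1 : Y ω = a⁻¹ * U ω := by simp [hY]
      have e2 : cos (arccos ρ) * Y ω - sin (arccos ρ) * X ω = b⁻¹ * V ω := by
        rw [hcos, hsin, hX, hY]; field_simp; ring
      rw [e2, e1, sgn_mul_pos _ _ (inv_pos.2 ha), sgn_mul_pos _ _ (inv_pos.2 hb)]
    rw [this, measureReal_def, key, ENNReal.toReal_ofReal (by positivity), arccos]
    field_simp
  · have m1 : Measurable fun p : ℝ × ℝ => sgn p.2 := measurable_sgn.comp measurable_snd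
    have m2 : Measurable fun p : ℝ × ℝ =>
        sgn (cos (arccos ρ) * p.2 - sin (arccos ρ) * p.1) :=
      measurable_sgn.comp (by fun_prop)
    exact (measurableSet_eq_fun m1 m2).compl

lemma aux_comb {Ω : Type*} [MeasurableSpace Ω] {μ : Measure Ω} [IsProbabilityMeasure μ]
    {A B C : Ω → ℝ} (hA : AEMeasurable A μ) (hB : AEMeasurable B μ) (hC : AEMeasurable C μ) :
    μ.real {ω | sgn (A ω) = sgn (B ω) ∧ sgn (A ω) ≠ sgn (C ω)} =
     (μ.real {ω | sgn (A ω) ≠ sgn (C ω)} + μ.real {ω | sgn (B ω) ≠ sgn (C ω)}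
      - μ.real {ω | sgn (A ω) ≠ sgn (B ω)}) / 2 := by
  have nm : ∀ {A B : Ω → ℝ}, AEMeasurable A μ → AEMeasurable B μ →
      NullMeasurableSet {ω | sgn (A ω) ≠ sgn (B ω)} μ := by
    intro A B hA hB
    exact (nullMeasurableSet_eq_fun (measurable_sgn.comp_aemeasurable hA)
      (measurable_sgn.comp_aemeasurable hB)).compl
  have split : ∀ S T : Set Ω, NullMeasurableSet T μ →
      μ.real S = μ.real (S ∩ T) + μ.real (S \ T) := fun S T hT =>
    (measureReal_inter_add_sdiff₀ hT).symm
  have n1 := split {ω | sgn (A ω) ≠ sgn (C ω)} _ (nm hA hB)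
  have n2 := split {ω | sgn (B ω) ≠ sgn (C ω)} _ (nm hA hB)
  have n3 := split {ω | sgn (A ω) ≠ sgn (B ω)} _ (nm hA hC)
  have e1 : {ω | sgn (A ω) ≠ sgn (C ω)} \ {ω | sgn (A ω) ≠ sgn (B ω)} =
      {ω | sgn (A ω) = sgn (B ω) ∧ sgn (A ω) ≠ sgn (C ω)} := by
    ext ω; simp only [Set.mem_sdiff, Set.mem_ofPred_eq]; tauto
  have e2 : {ω | sgn (B ω) ≠ sgn (C ω)} \ {ω | sgn (A ω) ≠ sgn (B ω)} =
      {ω | sgn (A ω) = sgn (B ω) ∧ sgn (A ω) ≠ sgn (C ω)} := by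
    ext ω; simp only [Set.mem_sdiff, Set.mem_ofPred_eq, not_not]
    constructor
    · rintro ⟨h, h'⟩; exact ⟨h', h' ▸ h⟩
    · rintro ⟨h, h'⟩; exact ⟨h ▸ h', h⟩
  have e3 : {ω | sgn (A ω) ≠ sgn (B ω)} \ {ω | sgn (A ω) ≠ sgn (C ω)} =
      {ω | sgn (B ω) ≠ sgn (C ω)} ∩ {ω | sgn (A ω) ≠ sgn (B ω)} := by
    ext ω; simp only [Set.mem_sdiff, Set.mem_inter_iff, Set.mem_ofPred_eq, sgn_ne_iff]; tauto
  rw [e1] at n1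
  rw [e2] at n2
  rw [e3, Set.inter_comm] at n3
  linarith

lemma cov_lin {p : ℕ} {Ω : Type*} [MeasurableSpace Ω] {μ : Measure Ω} [IsProbabilityMeasure μ]
    {x : Ω → (Fin p → ℝ)} {ε : Ω → ℝ} {σ : ℝ} (v : NNReal) (hv : (v : ℝ) = σ ^ 2)
    (hx : Measure.map x μ = Measure.pi fun _ : Fin p => gaussianReal 0 1)
    (hε : Measure.map ε μ = gaussianReal 0 v)
    (hind : IndepFun x ε μ) :
    HasGaussianLaw (fun ω => (x ω, ε ω)) μ ∧
    (∀ u : Fin p → ℝ, ∀ c : ℝ, ∫ ω, (∑ j, x ω j * u j + c * ε ω) ∂μ = 0) ∧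
    (∀ u v : Fin p → ℝ, ∀ c d : ℝ, cov[fun ω => ∑ j, x ω j * u j + c * ε ω,
      fun ω => ∑ j, x ω j * v j + d * ε ω; μ] = ∑ j, u j * v j + c * d * σ ^ 2) := by
  have xm : AEMeasurable x μ := AEMeasurable.of_map_ne_zero (by
    rw [hx]; exact IsProbabilityMeasure.ne_zero _)
  have lx : ∀ j, μ.map (fun ω => x ω j) = gaussianReal 0 1 := by
    intro j
    have : (fun ω => x ω j) = (Function.eval j) ∘ x := rfl
    rw [this, ← AEMeasurable.map_map_of_aemeasurable (measurable_pi_apply j).aemeasurable xm, hx]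
    exact (measurePreserving_eval _ j).map_eq
  have gj : ∀ j, HasGaussianLaw (fun ω => x ω j) μ := fun j =>
    ⟨by rw [lx j]; infer_instance⟩
  have ge : HasGaussianLaw ε μ := ⟨by rw [hε]; infer_instance⟩
  have ii : iIndepFun (fun j ω => x ω j) μ := by
    rw [iIndepFun_iff_map_fun_eq_pi_map (fun j => (gj j).aemeasurable)]
    simp only [lx]
    exact hx
  have gx : HasGaussianLaw x μ := ii.hasGaussianLaw gj
  have mj : ∀ j, MemLp (fun ω => x ω j) 2 μ := fun j => (gj j).memLp_two
  have me : MemLp ε 2 μ := ge.memLp_two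
  have Ej : ∀ j, ∫ ω, x ω j ∂μ = 0 := by
    intro j
    have := integral_map (gj j).aemeasurable (f := fun y : ℝ => y) (by fun_prop)
    rw [← this, lx j, integral_id_gaussianReal]
  have Ee : ∫ ω, ε ω ∂μ = 0 := by
    have := integral_map ge.aemeasurable (f := fun y : ℝ => y) (by fun_prop)
    rw [← this, hε, integral_id_gaussianReal]
  have Vj : ∀ j, cov[fun ω => x ω j, fun ω => x ω j; μ] = 1 := by
    intro j
    rw [covariance_self (gj j).aemeasurable, ← variance_id_map (gj j).aemeasurable, lx j,
      variance_id_gaussianReal]; rfl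
  have Ve : cov[ε, ε; μ] = σ ^ 2 := by
    rw [covariance_self ge.aemeasurable, ← variance_id_map ge.aemeasurable, hε,
      variance_id_gaussianReal, hv]
  have Cij : ∀ i j, cov[fun ω => x ω i, fun ω => x ω j; μ] = if i = j then 1 else 0 := by
    intro i j
    split_ifs with h
    · subst h; exact Vj i
    · exact (ii.indepFun h).covariance_eq_zero (mj i) (mj j)
  have Cje : ∀ j, cov[fun ω => x ω j, ε; μ] = 0 := by
    intro j
    exact (hind.comp (measurable_pi_apply j) measurable_id).covariance_eq_zero (mj j) me
  have mS : ∀ u : Fin p → ℝ, MemLp (fun ω => ∑ j, x ω j * u j) 2 μ := fun u =>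
    memLp_finsetSum _ (fun j _ => (mj j).mul_const _)
  have CSe : ∀ u : Fin p → ℝ, cov[fun ω => ∑ j, x ω j * u j, ε; μ] = 0 := by
    intro u
    rw [covariance_fun_sum_left (fun j => (mj j).mul_const _) me]
    simp [covariance_mul_const_left, Cje]
  have CSS : ∀ u v : Fin p → ℝ, cov[fun ω => ∑ j, x ω j * u j, fun ω => ∑ j, x ω j * v j; μ]
      = ∑ j, u j * v j := by
    intro u v
    rw [covariance_fun_sum_fun_sum (fun j => (mj j).mul_const _) (fun j => (mj j).mul_const _)]
    simp [covariance_mul_const_left, covariance_mul_const_right, Cij]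
  refine ⟨hind.hasGaussianLaw gx ge, ?_, ?_⟩
  · intro u c
    rw [integral_add ((mS u).integrable one_le_two) ((me.integrable one_le_two).const_mul _),
      integral_finsetSum _ (fun j _ => ((mj j).integrable one_le_two).mul_const _)]
    simp [integral_mul_const, integral_const_mul, Ej, Ee]
  · intro u v c d
    have e : ∀ u : Fin p → ℝ, ∀ c : ℝ, (fun ω => ∑ j, x ω j * u j + c * ε ω) =
      (fun ω => ∑ j, x ω j * u j) + c • ε := by intro u c; ext ω; simp
    rw [e, e, covariance_add_left (mS u) (me.const_smul _) ((mS v).add (me.const_smul _)),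
      covariance_add_right (mS u) (mS v) (me.const_smul _),
      covariance_add_right (me.const_smul _) (mS v) (me.const_smul _)]
    simp only [covariance_smul_left, covariance_smul_right]
    rw [covariance_comm ε, CSe, CSe, CSS, Ve]; ring

lemma sum01 {p k : ℕ} (w : Fin p → ℝ) (hw01 : ∀ j, w j = 0 ∨ w j = 1)
    (hwk : (Finset.univ.filter fun j => w j ≠ 0).card = k) : ∑ j, w j * w j = (k : ℝ) := by
  rw [← hwk, Finset.card_filter]
  push_cast
  refine Finset.sum_congr rfl fun j _ => ?_
  rcases hw01 j with h | h <;> simp [h]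

/-- Probability that the noisy sign agrees with the truth but disagrees with a `k`-sparse
binary classifier `w` sharing `ℓ` true features. -/
theorem orthant_probability_true_and_wrong
    {Ω : Type*} [MeasurableSpace Ω] (μ : Measure Ω) [IsProbabilityMeasure μ]
    (p k ℓ : ℕ) (hp : 1 ≤ p) (hk : 1 ≤ k) (hℓk : ℓ < k)
    (σ : ℝ) (hσ : 0 < σ)
    (x : Ω → (Fin p → ℝ)) (ε : Ω → ℝ)
    (hx : Measure.map x μ = Measure.pi fun _ : Fin p => gaussianReal 0 1)
    (hε : Measure.map ε μ = gaussianReal 0 ⟨σ ^ 2, sq_nonneg σ⟩)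
    (hind : IndepFun x ε μ)
    (w wstar : Fin p → ℝ)
    (hw01 : ∀ j, w j = 0 ∨ w j = 1) (hwstar01 : ∀ j, wstar j = 0 ∨ wstar j = 1)
    (hwk : (Finset.univ.filter fun j => w j ≠ 0).card = k)
    (hwstark : (Finset.univ.filter fun j => wstar j ≠ 0).card = k)
    (hℓ : ∑ j, w j * wstar j = (ℓ : ℝ)) :
    (μ {ω | sgn (∑ j, x ω j * wstar j + ε ω) = sgn (∑ j, x ω j * wstar j)
          ∧ sgn (∑ j, x ω j * wstar j + ε ω) ≠ sgn (∑ j, x ω j * w j)}).toReal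
      = (1 / (2 * π)) * (π / 2
          - Real.arcsin ((ℓ : ℝ) / Real.sqrt ((k : ℝ) * ((k : ℝ) + σ ^ 2)))
          + Real.arcsin ((k : ℝ) / Real.sqrt ((k : ℝ) * ((k : ℝ) + σ ^ 2)))
          - Real.arcsin ((ℓ : ℝ) / (k : ℝ))) := by
  obtain ⟨hg, hE, hcov⟩ := cov_lin (σ := σ) ⟨σ ^ 2, sq_nonneg σ⟩ rfl hx hε hind
  have kw := sum01 w hw01 hwk
  have kws := sum01 wstar hwstar01 hwstark
  have hℓ' : ∑ j, wstar j * w j = (ℓ : ℝ) := by rw [← hℓ]; simp only [mul_comm]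
  have hk0 : (0:ℝ) < k := by exact_mod_cast hk
  have hlk : (ℓ:ℝ) < k := by exact_mod_cast hℓk
  have hl0 : (0:ℝ) ≤ ℓ := by positivity
  have hpi := Real.pi_pos
  have pairG : ∀ (u v : Fin p → ℝ) (c d : ℝ), HasGaussianLaw (fun ω =>
      (∑ j, x ω j * u j + c * ε ω, ∑ j, x ω j * v j + d * ε ω)) μ := by
    intro u v c d
    have := hg.map_fun
      (((∑ j, (u j) • ((ContinuousLinearMap.proj (R := ℝ) (φ := fun _ : Fin p => ℝ) j).comp
          (ContinuousLinearMap.fst ℝ (Fin p → ℝ) ℝ)))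
        + c • ContinuousLinearMap.snd ℝ (Fin p → ℝ) ℝ).prod
       ((∑ j, (v j) • ((ContinuousLinearMap.proj (R := ℝ) (φ := fun _ : Fin p => ℝ) j).comp
          (ContinuousLinearMap.fst ℝ (Fin p → ℝ) ℝ)))
        + d • ContinuousLinearMap.snd ℝ (Fin p → ℝ) ℝ))
    simpa [mul_comm] using this
  set D := √((k:ℝ) * (k + σ ^ 2)) with hD
  have hD2 : D = √(k + σ ^ 2) * √k := by
    rw [hD, Real.sqrt_mul hk0.le, mul_comm]
  have hDk : (k:ℝ) < D := by
    rw [hD]; apply Real.lt_sqrt_of_sq_lt; nlinarith [mul_pos hk0 (pow_pos hσ 2)]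
  have hD0 : 0 < D := hk0.trans hDk
  have ha : 0 < √(k + σ ^ 2) := Real.sqrt_pos.2 (by positivity)
  have hb : 0 < √(k:ℝ) := Real.sqrt_pos.2 hk0
  have ha2 : √(k + σ ^ 2) ^ 2 = k + σ ^ 2 := Real.sq_sqrt (by positivity)
  have hb2 : √(k:ℝ) ^ 2 = k := Real.sq_sqrt hk0.le
  have hAC := aux_pair (pairG wstar w 1 0) (hE _ _) (hE _ _) (√(k + σ ^ 2)) (√k) (ℓ / D) ha hb
    (by rw [abs_of_nonneg (by positivity), div_lt_one hD0]; linarith)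
    (by rw [hcov, kws, ha2]; ring) (by rw [hcov, kw, hb2]; ring)
    (by rw [hcov, hℓ', ← hD2]; field_simp; ring)
  have hBC := aux_pair (pairG wstar w 0 0) (hE _ _) (hE _ _) (√k) (√k) (ℓ / k) hb hb
    (by rw [abs_of_nonneg (by positivity), div_lt_one hk0]; linarith)
    (by rw [hcov, kws, hb2]; ring) (by rw [hcov, kw, hb2]; ring)
    (by rw [hcov, hℓ', Real.mul_self_sqrt hk0.le]; field_simp; ring)
  have hAB := aux_pair (pairG wstar wstar 1 0) (hE _ _) (hE _ _) (√(k + σ ^ 2)) (√k) (k / D) ha hb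
    (by rw [abs_of_nonneg (by positivity), div_lt_one hD0]; linarith)
    (by rw [hcov, kws, ha2]; ring) (by rw [hcov, kws, hb2]; ring)
    (by rw [hcov, kws, ← hD2]; field_simp; ring)
  have comb := aux_comb (pairG wstar w 1 0).fst.aemeasurable (pairG wstar w 0 0).fst.aemeasurable
    (pairG wstar w 1 0).snd.aemeasurable
  rw [hAC, hBC, hAB] at comb
  simp only [one_mul, zero_mul, add_zero] at comb
  rw [← measureReal_def, comb]
  field_simp
  ring
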